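/- For all reals a⁻, a⁺ > 1 there exist constants c, C > 0 depending only on a⁻ and a⁺ such that for all integers N⁻, N⁺ ≥ 0 with N⁻ + N⁺ ≥ 1, the spectral gap λ of the Metropolis chain for the measure π on {−N⁻,…,N⁺} satisfies c·m ≤ λ ≤ C·m, where m = min{ 1/(N⁻+N⁺)², max{ (1+N⁻)^{−(1+a⁻)}, (1+N⁺)^{−(1+a⁺)} } }. -/

import Mathlib

open Finset

/-- The unnormalized density `F(x) = (1+|x|)^{a⁻}` for `x ≤ 0` and
`(1+|x|)^{a⁺}` for `x > 0` on `ℤ`. -/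
noncomputable def metroF (am ap : ℝ) (x : ℤ) : ℝ :=
  if x ≤ 0 then ((1 + |x| : ℤ) : ℝ) ^ am else ((1 + |x| : ℤ) : ℝ) ^ ap

/-- The probability measure on `{-N⁻,…,N⁺}` proportional to `metroF`. -/
noncomputable def metroPi (am ap : ℝ) (Nm Np : ℤ) (x : ℤ) : ℝ :=
  metroF am ap x / ∑ y ∈ Finset.Icc (-Nm) Np, metroF am ap y

/-- Dirichlet form of the Metropolis chain for `metroPi` based on
nearest-neighbor random walk on `{-N⁻,…,N⁺}`. -/
noncomputable def metroDirichlet (am ap : ℝ) (Nm Np : ℤ) (u : ℤ → ℝ) : ℝ :=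
  ∑ x ∈ Finset.Icc (-Nm) (Np - 1),
    (u (x + 1) - u x) ^ 2 *
      (1 / 2 * min (metroPi am ap Nm Np x) (metroPi am ap Nm Np (x + 1)))

/-- Variance with respect to `metroPi`. -/
noncomputable def metroVar (am ap : ℝ) (Nm Np : ℤ) (u : ℤ → ℝ) : ℝ :=
  ∑ x ∈ Finset.Icc (-Nm) Np,
    (u x - ∑ y ∈ Finset.Icc (-Nm) Np, u y * metroPi am ap Nm Np y) ^ 2 *
      metroPi am ap Nm Np x

/-- Spectral gap of the Metropolis chain:
`λ = inf { ℰ(u,u)/Var_π(u) : Var_π(u) ≠ 0 }`. -/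
noncomputable def metroGap (am ap : ℝ) (Nm Np : ℤ) : ℝ :=
  sInf {r : ℝ | ∃ u : ℤ → ℝ, metroVar am ap Nm Np u ≠ 0 ∧
    r = metroDirichlet am ap Nm Np u / metroVar am ap Nm Np u}

theorem metroF_of_nonpos {am ap : ℝ} {x : ℤ} (hx : x ≤ 0) :
    metroF am ap x = (1 - (x : ℝ)) ^ am := by
  rw [metroF, if_pos hx, abs_of_nonpos hx]
  push_cast
  rw [sub_eq_add_neg]

theorem metroF_of_nonneg {am ap : ℝ} {x : ℤ} (hx : 0 ≤ x) :
    metroF am ap x = (1 + (x : ℝ)) ^ ap := by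
  rcases hx.eq_or_lt with rfl | h
  · simp [metroF]
  · rw [metroF, if_neg (not_le.2 h), abs_of_nonneg hx]
    push_cast
    rfl

theorem metroF_pos (am ap : ℝ) (x : ℤ) : 0 < metroF am ap x := by
  rcases le_total x 0 with h | h
  · rw [metroF_of_nonpos h]
    have : (x : ℝ) ≤ 0 := by exact_mod_cast h
    exact Real.rpow_pos_of_pos (by linarith) _
  · rw [metroF_of_nonneg h]
    have : (0 : ℝ) ≤ x := by exact_mod_cast h
    exact Real.rpow_pos_of_pos (by linarith) _

theorem metroF_neg (am ap : ℝ) (x : ℤ) : metroF am ap (-x) = metroF ap am x := by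
  rcases le_total x 0 with h | h
  · rw [metroF_of_nonpos h, metroF_of_nonneg (neg_nonneg.2 h)]
    push_cast
    rw [sub_eq_add_neg]
  · rw [metroF_of_nonneg h, metroF_of_nonpos (neg_nonpos.2 h)]
    push_cast
    rw [sub_neg_eq_add]

theorem metroF_sum_pos (am ap : ℝ) {Nm Np : ℤ} (hm : 0 ≤ Nm) (hp : 0 ≤ Np) :
    0 < ∑ y ∈ Icc (-Nm) Np, metroF am ap y :=
  sum_pos (fun x _ => metroF_pos am ap x) ⟨0, by simp; omega⟩

/-- Reflection of sums over integer intervals. -/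
theorem sum_Icc_int_neg (f : ℤ → ℝ) (a b : ℤ) :
    ∑ x ∈ Icc (-a) b, f (-x) = ∑ x ∈ Icc (-b) a, f x :=
  sum_nbij' (fun x => -x) (fun x => -x) (by simp; omega) (by simp; omega)
    (by simp) (by simp) (by simp)

theorem metroPi_neg (am ap : ℝ) (Nm Np x : ℤ) :
    metroPi am ap Nm Np (-x) = metroPi ap am Np Nm x := by
  rw [metroPi, metroPi, metroF_neg, ← sum_Icc_int_neg]
  simp_rw [metroF_neg]

theorem metroVar_reflect (am ap : ℝ) (Nm Np : ℤ) (u : ℤ → ℝ) :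
    metroVar am ap Nm Np (fun x => u (-x)) = metroVar ap am Np Nm u := by
  have hmean : ∑ y ∈ Icc (-Nm) Np, u (-y) * metroPi am ap Nm Np y =
      ∑ y ∈ Icc (-Np) Nm, u y * metroPi ap am Np Nm y := by
    rw [← sum_Icc_int_neg _ Nm Np]
    exact sum_congr rfl fun x _ => by rw [metroPi_neg]
  rw [metroVar, metroVar, hmean, ← sum_Icc_int_neg (fun x => (u x -
    ∑ y ∈ Icc (-Np) Nm, u y * metroPi ap am Np Nm y) ^ 2 * metroPi ap am Np Nm x) Nm Np]
  exact sum_congr rfl fun x _ => by rw [metroPi_neg]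

theorem metroDirichlet_reflect (am ap : ℝ) (Nm Np : ℤ) (u : ℤ → ℝ) :
    metroDirichlet am ap Nm Np (fun x => u (-x)) = metroDirichlet ap am Np Nm u := by
  rw [metroDirichlet, metroDirichlet]
  refine sum_nbij' (fun x => -x - 1) (fun x => -x - 1) (by simp; omega) (by simp; omega)
    (by simp) (by simp) fun x _ => ?_
  have h1 : -x - 1 + 1 = -x := by ring
  have h2 : -x - 1 = -(x + 1) := by ring
  rw [h1, h2, metroPi_neg, metroPi_neg, min_comm]
  ring

theorem metroGap_reflect (am ap : ℝ) (Nm Np : ℤ) :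
    metroGap am ap Nm Np = metroGap ap am Np Nm := by
  have key : ∀ (am ap : ℝ) (Nm Np : ℤ) (r : ℝ),
      (∃ u : ℤ → ℝ, metroVar am ap Nm Np u ≠ 0 ∧
        r = metroDirichlet am ap Nm Np u / metroVar am ap Nm Np u) →
      ∃ u : ℤ → ℝ, metroVar ap am Np Nm u ≠ 0 ∧
        r = metroDirichlet ap am Np Nm u / metroVar ap am Np Nm u := by
    rintro am ap Nm Np r ⟨u, hu, hr⟩
    refine ⟨fun x => u (-x), ?_⟩
    rw [metroVar_reflect, metroDirichlet_reflect]
    exact ⟨hu, hr⟩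
  rw [metroGap, metroGap]
  congr 1
  ext r
  exact ⟨key am ap Nm Np r, key ap am Np Nm r⟩

/-- The Dirichlet form in terms of the unnormalized density. -/
theorem metroDirichlet_eq (am ap : ℝ) {Nm Np : ℤ} (hm : 0 ≤ Nm) (hp : 0 ≤ Np) (u : ℤ → ℝ) :
    metroDirichlet am ap Nm Np u =
      (1 / 2 * ∑ x ∈ Icc (-Nm) (Np - 1),
        min (metroF am ap x) (metroF am ap (x + 1)) * (u (x + 1) - u x) ^ 2) /
        ∑ y ∈ Icc (-Nm) Np, metroF am ap y := by
  rw [metroDirichlet, mul_sum, sum_div]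
  refine sum_congr rfl fun x _ => ?_
  rw [metroPi, metroPi, min_div_div_right (metroF_sum_pos am ap hm hp).le]
  ring

theorem metroVar_eq (am ap : ℝ) (Nm Np : ℤ) (u : ℤ → ℝ) :
    metroVar am ap Nm Np u =
      (∑ x ∈ Icc (-Nm) Np,
        (u x - ∑ y ∈ Icc (-Nm) Np, u y * metroPi am ap Nm Np y) ^ 2 * metroF am ap x) /
        ∑ y ∈ Icc (-Nm) Np, metroF am ap y := by
  rw [metroVar, sum_div]
  refine sum_congr rfl fun x _ => ?_
  rw [metroPi, mul_div_assoc]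

/-- The variance of a finite probability weight minimizes the mean square deviation. -/
theorem sum_sq_sub_mean_le {ι : Type*} (s : Finset ι) (p u : ι → ℝ) (hp : ∑ x ∈ s, p x = 1)
    (t : ℝ) :
    ∑ x ∈ s, (u x - ∑ y ∈ s, u y * p y) ^ 2 * p x ≤ ∑ x ∈ s, (u x - t) ^ 2 * p x := by
  set m := ∑ y ∈ s, u y * p y with hm
  have : ∑ x ∈ s, (u x - t) ^ 2 * p x =
      ∑ x ∈ s, (u x - m) ^ 2 * p x + (2 * (m - t) * (∑ x ∈ s, u x * p x)
        - (m - t) * (m + t) * ∑ x ∈ s, p x) := by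
    rw [mul_sum, mul_sum, ← sum_sub_distrib, ← sum_add_distrib]
    exact sum_congr rfl fun x _ => by ring
  rw [this, ← hm, hp]
  nlinarith [sq_nonneg (m - t)]

theorem metroVar_le (am ap : ℝ) {Nm Np : ℤ} (hm : 0 ≤ Nm) (hp : 0 ≤ Np) (u : ℤ → ℝ) (t : ℝ) :
    metroVar am ap Nm Np u ≤
      (∑ x ∈ Icc (-Nm) Np, (u x - t) ^ 2 * metroF am ap x) /
        ∑ y ∈ Icc (-Nm) Np, metroF am ap y := by
  have h := sum_sq_sub_mean_le (Icc (-Nm) Np) (metroPi am ap Nm Np) u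
    (by simp only [metroPi]; rw [← sum_div]; exact div_self (metroF_sum_pos am ap hm hp).ne') t
  refine h.trans_eq ?_
  rw [sum_div]
  refine sum_congr rfl fun x _ => ?_
  rw [metroPi, mul_div_assoc]

theorem metroVar_nonneg (am ap : ℝ) {Nm Np : ℤ} (hm : 0 ≤ Nm) (hp : 0 ≤ Np) (u : ℤ → ℝ) :
    0 ≤ metroVar am ap Nm Np u := by
  rw [metroVar_eq]
  exact div_nonneg (sum_nonneg fun x _ => mul_nonneg (sq_nonneg _) (metroF_pos am ap x).le)
    (metroF_sum_pos am ap hm hp).le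

theorem metroDirichlet_nonneg (am ap : ℝ) {Nm Np : ℤ} (hm : 0 ≤ Nm) (hp : 0 ≤ Np)
    (u : ℤ → ℝ) : 0 ≤ metroDirichlet am ap Nm Np u := by
  rw [metroDirichlet_eq am ap hm hp]
  refine div_nonneg (mul_nonneg (by norm_num) (sum_nonneg fun x _ => mul_nonneg ?_ (sq_nonneg _)))
    (metroF_sum_pos am ap hm hp).le
  exact le_min (metroF_pos am ap x).le (metroF_pos am ap _).le

/-- A test function bounds the spectral gap from above. -/
theorem metroGap_le (am ap : ℝ) {Nm Np : ℤ} (hm : 0 ≤ Nm) (hp : 0 ≤ Np) (u : ℤ → ℝ) {r V : ℝ}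
    (hV : 0 < V) (hr : 0 ≤ r)
    (hvar : ∀ t : ℝ, V ≤ ∑ x ∈ Icc (-Nm) Np, (u x - t) ^ 2 * metroF am ap x)
    (hdir : 1 / 2 * ∑ x ∈ Icc (-Nm) (Np - 1),
      min (metroF am ap x) (metroF am ap (x + 1)) * (u (x + 1) - u x) ^ 2 ≤ r * V) :
    metroGap am ap Nm Np ≤ r := by
  have hZ := metroF_sum_pos am ap hm hp
  have hvp : V / (∑ y ∈ Icc (-Nm) Np, metroF am ap y) ≤ metroVar am ap Nm Np u := by
    rw [metroVar_eq]
    gcongr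
    exact hvar _
  have hpos : 0 < metroVar am ap Nm Np u := (div_pos hV hZ).trans_le hvp
  rw [metroGap]
  refine (csInf_le (a := metroDirichlet am ap Nm Np u / metroVar am ap Nm Np u) ⟨0, ?_⟩
    (by exact ⟨u, hpos.ne', rfl⟩)).trans ?_
  · rintro _ ⟨v, -, rfl⟩
    exact div_nonneg (metroDirichlet_nonneg am ap hm hp v) (metroVar_nonneg am ap hm hp v)
  · rw [div_le_iff₀ hpos]
    refine le_trans ?_ (mul_le_mul_of_nonneg_left hvp hr)
    rw [metroDirichlet_eq am ap hm hp, ← mul_div_assoc]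
    gcongr

/-- A Poincaré inequality bounds the spectral gap from below. -/
theorem le_metroGap (am ap : ℝ) {Nm Np : ℤ} (hm : 0 ≤ Nm) (hp : 0 ≤ Np) (hN : 1 ≤ Nm + Np)
    {r : ℝ} (hr : 0 ≤ r)
    (h : ∀ u : ℤ → ℝ, ∃ t : ℝ, r * ∑ x ∈ Icc (-Nm) Np, (u x - t) ^ 2 * metroF am ap x ≤
      1 / 2 * ∑ x ∈ Icc (-Nm) (Np - 1),
        min (metroF am ap x) (metroF am ap (x + 1)) * (u (x + 1) - u x) ^ 2) :
    r ≤ metroGap am ap Nm Np := by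
  have hZ := metroF_sum_pos am ap hm hp
  refine le_csInf ?_ ?_
  · refine ⟨_, fun x => (x : ℝ), ?_, rfl⟩
    rw [metroVar_eq]
    set m := ∑ y ∈ Icc (-Nm) Np, (y : ℝ) * metroPi am ap Nm Np y
    refine (div_pos ?_ hZ).ne'
    refine sum_pos' (fun x _ => mul_nonneg (sq_nonneg _) (metroF_pos am ap x).le) ?_
    by_cases hz : (Np : ℝ) = m
    · refine ⟨-Nm, by simp; omega, mul_pos (sq_pos_of_ne_zero ?_) (metroF_pos am ap _)⟩
      have h1 : (1 : ℝ) ≤ Nm + Np := by exact_mod_cast hN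
      push_cast
      intro h0
      linarith
    · exact ⟨Np, by simp; omega,
        mul_pos (sq_pos_of_ne_zero (sub_ne_zero.2 hz)) (metroF_pos am ap _)⟩
  · rintro _ ⟨u, hu, rfl⟩
    have hpos := lt_of_le_of_ne (metroVar_nonneg am ap hm hp u) hu.symm
    obtain ⟨t, ht⟩ := h u
    rw [le_div_iff₀ hpos]
    refine (mul_le_mul_of_nonneg_left (metroVar_le am ap hm hp u t) hr).trans ?_
    rw [metroDirichlet_eq am ap hm hp, ← mul_div_assoc]
    gcongr

/-- Cauchy–Schwarz along an integer path. -/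
theorem sq_sub_le_sum_inv_mul_sum (w u : ℤ → ℝ) (hw : ∀ x, 0 < w x) {a b : ℤ} (hab : a ≤ b) :
    (u a - u b) ^ 2 ≤ (∑ x ∈ Icc a (b - 1), (w x)⁻¹) *
      ∑ x ∈ Icc a (b - 1), w x * (u (x + 1) - u x) ^ 2 := by
  have htel : ∑ x ∈ Icc a (b - 1), (u (x + 1) - u x) = u b - u a := by
    induction b, hab using Int.leInduction with
    | base => simp
    | succ b hb ih =>
      have : Icc a (b + 1 - 1) = insert b (Icc a (b - 1)) := by
        ext x; simp; omega
      rw [this, sum_insert (by simp), ih]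
      ring
  rw [← neg_sub (u b), neg_sq, ← htel]
  refine sum_sq_le_sum_mul_sum_of_sq_le_mul _ (fun x _ => (inv_pos.2 (hw x)).le)
    (fun x _ => mul_nonneg (hw x).le (sq_nonneg _)) fun x _ => ?_
  rw [inv_mul_cancel_left₀ (hw x).ne']

theorem summable_inv_metroF {am ap : ℝ} (ham : 1 < am) (hap : 1 < ap) :
    Summable fun x : ℤ => (metroF am ap x)⁻¹ := by
  have key : ∀ a : ℝ, 1 < a → Summable fun n : ℕ => ((1 + (n : ℝ)) ^ a)⁻¹ := fun a ha => by
    have := (summable_nat_add_iff 1).2 (Real.summable_nat_rpow_inv.2 ha)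
    refine this.congr fun n => ?_
    push_cast
    rw [add_comm]
  refine Summable.of_nat_of_neg ?_ ?_
  · refine (key ap hap).congr fun n => ?_
    rw [metroF_of_nonneg (Int.natCast_nonneg n)]
    simp
  · refine (key am ham).congr fun n => ?_
    rw [metroF_neg, metroF_of_nonneg (Int.natCast_nonneg n)]
    simp

theorem exists_sum_inv_min_metroF_le {am ap : ℝ} (ham : 1 < am) (hap : 1 < ap) :
    ∃ K : ℝ, 0 < K ∧ ∀ s : Finset ℤ,
      ∑ x ∈ s, (min (metroF am ap x) (metroF am ap (x + 1)))⁻¹ ≤ K := by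
  have hs := summable_inv_metroF ham hap
  have hs' : Summable fun x : ℤ => (metroF am ap (x + 1))⁻¹ :=
    hs.comp_injective (add_left_injective (1 : ℤ))
  have hnn : ∀ x : ℤ, 0 ≤ (metroF am ap x)⁻¹ := fun x => (inv_pos.2 (metroF_pos am ap x)).le
  refine ⟨∑' x : ℤ, ((metroF am ap x)⁻¹ + (metroF am ap (x + 1))⁻¹) + 1, ?_, fun s => ?_⟩
  · have : 0 ≤ ∑' x : ℤ, ((metroF am ap x)⁻¹ + (metroF am ap (x + 1))⁻¹) :=
      tsum_nonneg fun x => add_nonneg (hnn x) (hnn (x + 1))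
    linarith
  · have h1 : ∑ x ∈ s, (min (metroF am ap x) (metroF am ap (x + 1)))⁻¹ ≤
        ∑ x ∈ s, ((metroF am ap x)⁻¹ + (metroF am ap (x + 1))⁻¹) := by
      refine sum_le_sum fun x _ => ?_
      rcases min_choice (metroF am ap x) (metroF am ap (x + 1)) with h | h <;> rw [h]
      · linarith [hnn (x + 1)]
      · linarith [hnn x]
    have h2 := (hs.add hs').sum_le_tsum s fun x _ => add_nonneg (hnn x) (hnn (x + 1))
    linarith

/-- Splitting of sums over `{-N⁻,…,N⁺}` into the nonpositive and the positive part. -/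
theorem sum_Icc_neg_split (f : ℤ → ℝ) {Nm Np : ℤ} (hm : 0 ≤ Nm) (hp : 0 ≤ Np) :
    ∑ x ∈ Icc (-Nm) Np, f x = ∑ x ∈ Icc (-Nm) 0, f x + ∑ x ∈ Icc 1 Np, f x := by
  rw [← sum_union (disjoint_left.2 fun x => by simp; omega)]
  congr 1
  ext x
  simp
  omega

theorem sum_metroF_nonpos_le {am : ℝ} (ham : 0 ≤ am) (ap : ℝ) {Nm : ℤ} (hm : 0 ≤ Nm) :
    ∑ x ∈ Icc (-Nm) 0, metroF am ap x ≤ (1 + (Nm : ℝ)) ^ (1 + am) := by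
  have hm' : (0 : ℝ) ≤ Nm := by exact_mod_cast hm
  have h : ∀ x ∈ Icc (-Nm) 0, metroF am ap x ≤ (1 + (Nm : ℝ)) ^ am := fun x hx => by
    rw [mem_Icc] at hx
    rw [metroF_of_nonpos hx.2]
    have h1 : (x : ℝ) ≤ 0 := by exact_mod_cast hx.2
    have h2 : -(Nm : ℝ) ≤ x := by exact_mod_cast hx.1
    exact Real.rpow_le_rpow (by linarith) (by linarith) ham
  refine (sum_le_card_nsmul _ _ _ h).trans_eq ?_
  have hc : (((Icc (-Nm) 0).card : ℕ) : ℝ) = 1 + Nm := by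
    have : (((Icc (-Nm) 0).card : ℕ) : ℤ) = 1 + Nm := by rw [Int.card_Icc]; omega
    exact_mod_cast this
  rw [nsmul_eq_mul, hc, Real.rpow_add (by linarith), Real.rpow_one]

theorem sum_metroF_pos_le (am : ℝ) {ap : ℝ} (hap : 0 ≤ ap) {Np : ℤ} (hp : 0 ≤ Np) :
    ∑ x ∈ Icc 1 Np, metroF am ap x ≤ (1 + (Np : ℝ)) ^ (1 + ap) := by
  refine le_trans ?_ (sum_metroF_nonpos_le hap am hp)
  rw [← sum_Icc_int_neg (metroF ap am) 0 Np]
  simp_rw [metroF_neg, neg_zero]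
  exact sum_le_sum_of_subset_of_nonneg (Icc_subset_Icc (by omega) le_rfl) fun x _ _ =>
    (metroF_pos am ap x).le

/-- The upper half of `{1,…,N⁺}` bounds its mass from below. -/
theorem le_sum_metroF_pos (am : ℝ) {ap : ℝ} (hap : 0 ≤ ap) {Np : ℤ} (hp : 1 ≤ Np) :
    ((1 + (Np : ℝ)) / 2) ^ (1 + ap) ≤ ∑ x ∈ Icc 1 Np, metroF am ap x := by
  have hp' : (1 : ℝ) ≤ Np := by exact_mod_cast hp
  have h : ∀ x ∈ Icc ((Np + 1) / 2) Np, ((1 + (Np : ℝ)) / 2) ^ ap ≤ metroF am ap x :=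
    fun x hx => by
    rw [mem_Icc] at hx
    rw [metroF_of_nonneg (by omega)]
    have h1 : (Np : ℝ) ≤ 2 * x := by exact_mod_cast (by omega : Np ≤ 2 * x)
    exact Real.rpow_le_rpow (by linarith) (by linarith) hap
  have hc : (1 + (Np : ℝ)) / 2 ≤ (((Icc ((Np + 1) / 2) Np).card : ℕ) : ℝ) := by
    have : 1 + Np ≤ 2 * (((Icc ((Np + 1) / 2) Np).card : ℕ) : ℤ) := by rw [Int.card_Icc]; omega
    have : 1 + (Np : ℝ) ≤ 2 * (((Icc ((Np + 1) / 2) Np).card : ℕ) : ℝ) := by exact_mod_cast this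
    linarith
  calc ((1 + (Np : ℝ)) / 2) ^ (1 + ap) = (1 + (Np : ℝ)) / 2 * ((1 + (Np : ℝ)) / 2) ^ ap := by
        rw [Real.rpow_add (by linarith), Real.rpow_one]
    _ ≤ ((Icc ((Np + 1) / 2) Np).card : ℝ) * ((1 + (Np : ℝ)) / 2) ^ ap := by gcongr
    _ ≤ ∑ x ∈ Icc ((Np + 1) / 2) Np, metroF am ap x := by
        rw [← nsmul_eq_mul]
        exact card_nsmul_le_sum _ _ _ h
    _ ≤ _ := by
        refine sum_le_sum_of_subset_of_nonneg (Icc_subset_Icc (by omega) le_rfl) fun x _ _ =>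
          (metroF_pos am ap x).le

theorem le_sum_metroF_nonpos {am : ℝ} (ham : 0 ≤ am) (ap : ℝ) {Nm : ℤ} (hm : 0 ≤ Nm) :
    ((1 + (Nm : ℝ)) / 2) ^ (1 + am) ≤ ∑ x ∈ Icc (-Nm) 0, metroF am ap x := by
  rw [← sum_Icc_int_neg (metroF am ap) 0 Nm]
  simp_rw [metroF_neg, neg_zero]
  rcases hm.eq_or_lt with rfl | hm
  · simp only [Int.cast_zero, add_zero, Icc_self, sum_singleton, metroF_of_nonneg le_rfl,
      Real.one_rpow]
    exact Real.rpow_le_one (by norm_num) (by norm_num) (by linarith)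
  · refine (le_sum_metroF_pos ap ham hm).trans ?_
    exact sum_le_sum_of_subset_of_nonneg (Icc_subset_Icc (by omega) le_rfl) fun x _ _ =>
          (metroF_pos ap am x).le

theorem exists_metroGap_le_cut {am ap : ℝ} (ham : 0 ≤ am) (hap : 0 ≤ ap) :
    ∃ C : ℝ, 0 < C ∧ ∀ Nm Np : ℤ, 0 ≤ Nm → 1 ≤ Np → metroGap am ap Nm Np ≤
      C * max ((1 + (Nm : ℝ)) ^ (-(1 + am))) ((1 + (Np : ℝ)) ^ (-(1 + ap))) := by
  refine ⟨2 ^ (1 + am) + 2 ^ (1 + ap), by positivity, fun Nm Np hm hp => ?_⟩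
  have hm' : (0 : ℝ) ≤ Nm := by exact_mod_cast hm
  have hp' : (1 : ℝ) ≤ Np := by exact_mod_cast hp
  have hSm := le_sum_metroF_nonpos ham ap hm
  have hSp := le_sum_metroF_pos am hap hp
  set Sm := ∑ x ∈ Icc (-Nm) 0, metroF am ap x with hSmdef
  set Sp := ∑ x ∈ Icc 1 Np, metroF am ap x with hSpdef
  set M := max ((1 + (Nm : ℝ)) ^ (-(1 + am))) ((1 + (Np : ℝ)) ^ (-(1 + ap))) with hM
  have inv_mass : ∀ (a y : ℝ), 0 < 1 + y →
      2 ^ (1 + a) * (1 + y) ^ (-(1 + a)) * ((1 + y) / 2) ^ (1 + a) = 1 := fun a y hy => by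
    rw [Real.div_rpow hy.le (by norm_num), Real.rpow_neg hy.le]
    have h1 := (Real.rpow_pos_of_pos hy (1 + a)).ne'
    have h2 := (Real.rpow_pos_of_pos (two_pos (α := ℝ)) (1 + a)).ne'
    field_simp
  have hMpos : 0 < M := lt_max_of_lt_left (Real.rpow_pos_of_pos (by linarith) _)
  have hm1 : 1 ≤ (2 ^ (1 + am) + 2 ^ (1 + ap)) * M * Sm := by
    refine (inv_mass am Nm (by linarith)).symm.trans_le ?_
    gcongr
    · have := Real.rpow_nonneg (zero_le_two (α := ℝ)) (1 + ap)
      linarith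
    · exact le_max_left _ _
  have hp1 : 1 ≤ (2 ^ (1 + am) + 2 ^ (1 + ap)) * M * Sp := by
    refine (inv_mass ap Np (by linarith)).symm.trans_le ?_
    gcongr
    · have := Real.rpow_nonneg (zero_le_two (α := ℝ)) (1 + am)
      linarith
    · exact le_max_right _ _
  have hSm0 : 0 < Sm := lt_of_lt_of_le (by positivity) hSm
  have hSp0 : 0 < Sp := lt_of_lt_of_le (by positivity) hSp
  refine metroGap_le am ap hm (by omega) (fun x => if x ≤ 0 then 1 else 0)
    (V := 1 / 2 * min Sm Sp) (by positivity) (by positivity) (fun t => ?_) ?_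
  · rw [sum_Icc_neg_split _ hm (by omega)]
    have e1 : ∑ x ∈ Icc (-Nm) 0, ((if x ≤ 0 then (1 : ℝ) else 0) - t) ^ 2 * metroF am ap x =
        (1 - t) ^ 2 * Sm := by
      rw [hSmdef, mul_sum]
      exact sum_congr rfl fun x hx => by rw [if_pos (mem_Icc.1 hx).2]
    have e2 : ∑ x ∈ Icc 1 Np, ((if x ≤ 0 then (1 : ℝ) else 0) - t) ^ 2 * metroF am ap x =
        t ^ 2 * Sp := by
      rw [hSpdef, mul_sum]
      refine sum_congr rfl fun x hx => ?_
      rw [if_neg (by have := (mem_Icc.1 hx).1; omega)]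
      ring
    rw [e1, e2]
    have h1 := mul_le_mul_of_nonneg_left (min_le_left Sm Sp) (sq_nonneg (1 - t))
    have h2 := mul_le_mul_of_nonneg_left (min_le_right Sm Sp) (sq_nonneg t)
    have h3 : 0 ≤ min Sm Sp := by positivity
    nlinarith [mul_nonneg h3 (sq_nonneg (2 * t - 1))]
  · rw [sum_eq_single 0]
    · have h0 : min (metroF am ap 0) (metroF am ap (0 + 1)) ≤ 1 :=
        (min_le_left _ _).trans_eq (by simp [metroF])
      have h1 : 1 ≤ (2 ^ (1 + am) + 2 ^ (1 + ap)) * M * min Sm Sp := by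
        rcases min_choice Sm Sp with h | h <;> rw [h] <;> assumption
      simp only [zero_add, le_refl, if_true, not_le.2 one_pos, if_false] at h0 ⊢
      linarith
    · intro x _ hx
      have : (if x + 1 ≤ 0 then (1 : ℝ) else 0) = if x ≤ 0 then 1 else 0 :=
        if_congr (by omega) rfl rfl
      rw [this]
      ring
    · intro h
      simp at h
      omega

/-- Consecutive integers have mean square deviation of cubic order from any point. -/
theorem le_sum_range_sq_sub (n : ℕ) (t : ℝ) :
    (n : ℝ) * (n ^ 2 - 1) / 12 ≤ ∑ i ∈ range n, ((i : ℝ) - t) ^ 2 := by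
  have h : ∑ i ∈ range n, ((i : ℝ) - t) ^ 2 =
      (n : ℝ) * (n ^ 2 - 1) / 12 + n * (t - (n - 1) / 2) ^ 2 := by
    induction n with
    | zero => simp
    | succ k ih =>
      rw [sum_range_succ, ih]
      push_cast
      ring
  rw [h]
  exact le_add_of_nonneg_right (by positivity)

theorem le_sum_sq_sub_mul_metroF (am : ℝ) {ap : ℝ} (hap : 0 ≤ ap) {Nm Np : ℤ} (hm : 0 ≤ Nm)
    (hp : 1 ≤ Np) (t : ℝ) :
    ((1 + (Np : ℝ)) / 2) ^ (1 + ap) * (1 + (Np : ℝ)) ^ 2 / 64 ≤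
      ∑ x ∈ Icc (-Nm) Np, ((x : ℝ) - t) ^ 2 * metroF am ap x := by
  have hp' : (1 : ℝ) ≤ Np := by exact_mod_cast hp
  obtain ⟨n, hn⟩ := Int.eq_ofNat_of_zero_le (show 0 ≤ Np - Np / 2 + 1 by omega)
  have hn2 : (2 : ℝ) ≤ n := by exact_mod_cast (by omega : 2 ≤ n)
  have hnN : 1 + (Np : ℝ) ≤ 2 * n := by exact_mod_cast (by omega : 1 + Np ≤ 2 * (n : ℤ))
  have hmap : ∑ x ∈ Icc (Np / 2) Np, ((x : ℝ) - t) ^ 2 =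
      ∑ i ∈ range n, ((i : ℝ) - (t - (Np / 2 : ℤ))) ^ 2 := by
    symm
    refine sum_nbij' (fun i : ℕ => (i : ℤ) + Np / 2) (fun x => (x - Np / 2).toNat)
      ?_ ?_ ?_ ?_ ?_
    · intro i hi
      simp only [mem_range, mem_Icc] at *
      omega
    · intro x hx
      simp only [mem_range, mem_Icc] at *
      omega
    · intro i hi
      simp
    · intro x hx
      simp only [mem_Icc] at *
      omega
    · intro i _
      push_cast
      ring
  calc ((1 + (Np : ℝ)) / 2) ^ (1 + ap) * (1 + (Np : ℝ)) ^ 2 / 64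
      = ((1 + (Np : ℝ)) / 2) ^ ap * ((1 + (Np : ℝ)) / 2 * (1 + (Np : ℝ)) ^ 2 / 64) := by
        rw [Real.rpow_add (by linarith), Real.rpow_one]
        ring
    _ ≤ ((1 + (Np : ℝ)) / 2) ^ ap * ((n : ℝ) * (n ^ 2 - 1) / 12) := by
        refine mul_le_mul_of_nonneg_left ?_ (by positivity)
        have h1 : (1 + (Np : ℝ)) / 2 ≤ n := by linarith
        have h2 : (1 + (Np : ℝ)) ^ 2 ≤ (2 * n) ^ 2 := by gcongr
        have h3 : 0 ≤ (n : ℝ) * (n ^ 2 - 4) := mul_nonneg (by linarith) (by nlinarith)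
        have h4 : (1 + (Np : ℝ)) / 2 * (1 + (Np : ℝ)) ^ 2 ≤ n * (2 * n) ^ 2 := by gcongr
        linarith
    _ ≤ ((1 + (Np : ℝ)) / 2) ^ ap * ∑ x ∈ Icc (Np / 2) Np, ((x : ℝ) - t) ^ 2 := by
        rw [hmap]
        gcongr
        exact le_sum_range_sq_sub n _
    _ ≤ ∑ x ∈ Icc (Np / 2) Np, ((x : ℝ) - t) ^ 2 * metroF am ap x := by
        rw [mul_sum]
        refine sum_le_sum fun x hx => ?_
        rw [mem_Icc] at hx
        rw [mul_comm, metroF_of_nonneg (by omega)]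
        have h1 : (Np : ℝ) ≤ 2 * x + 1 := by exact_mod_cast (by omega : Np ≤ 2 * x + 1)
        gcongr
        linarith
    _ ≤ _ := sum_le_sum_of_subset_of_nonneg (Icc_subset_Icc (by omega) le_rfl) fun x _ _ =>
        mul_nonneg (sq_nonneg _) (metroF_pos am ap x).le

theorem exists_metroGap_le_diffusive {am ap : ℝ} (ham : 0 ≤ am) (hap : 0 ≤ ap) :
    ∃ C : ℝ, 0 < C ∧ ∀ Nm Np : ℤ, 0 ≤ Nm → 1 ≤ Np → Nm ≤ Np →
      (1 + (Nm : ℝ)) ^ (1 + am) ≤ (1 + (Np : ℝ)) ^ (1 + ap) →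
      metroGap am ap Nm Np ≤ C * (1 / ((Nm : ℝ) + Np) ^ 2) := by
  refine ⟨256 * 2 ^ (1 + ap), by positivity, fun Nm Np hm hp hmp hQP => ?_⟩
  have hm' : (0 : ℝ) ≤ Nm := by exact_mod_cast hm
  have hp' : (1 : ℝ) ≤ Np := by exact_mod_cast hp
  have hmp' : (Nm : ℝ) ≤ Np := by exact_mod_cast hmp
  refine metroGap_le am ap hm (by omega) (fun x => (x : ℝ))
    (V := ((1 + (Np : ℝ)) / 2) ^ (1 + ap) * (1 + (Np : ℝ)) ^ 2 / 64) (by positivity)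
    (by positivity) (le_sum_sq_sub_mul_metroF am hap hm hp) ?_
  have hZ : ∑ x ∈ Icc (-Nm) (Np - 1), min (metroF am ap x) (metroF am ap (x + 1)) *
      (((x + 1 : ℤ) : ℝ) - x) ^ 2 ≤ 2 * (1 + (Np : ℝ)) ^ (1 + ap) := by
    calc _ ≤ ∑ x ∈ Icc (-Nm) (Np - 1), metroF am ap x := sum_le_sum fun x _ => by
          push_cast
          simp
      _ ≤ ∑ x ∈ Icc (-Nm) Np, metroF am ap x :=
          sum_le_sum_of_subset_of_nonneg (Icc_subset_Icc le_rfl (by omega)) fun x _ _ =>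
            (metroF_pos am ap x).le
      _ ≤ _ := by
          rw [sum_Icc_neg_split _ hm (by omega)]
          linarith [sum_metroF_nonpos_le ham ap hm, sum_metroF_pos_le am hap (by omega : 0 ≤ Np)]
  have hP : 0 < (1 + (Np : ℝ)) ^ (1 + ap) := by positivity
  have h2 : 0 < (2 : ℝ) ^ (1 + ap) := by positivity
  calc _ ≤ (1 + (Np : ℝ)) ^ (1 + ap) := by linarith
    _ ≤ (1 + (Np : ℝ)) ^ (1 + ap) * (4 * (1 + (Np : ℝ)) ^ 2 / ((Nm : ℝ) + Np) ^ 2) := by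
        refine le_mul_of_one_le_right hP.le ?_
        rw [one_le_div (by positivity)]
        nlinarith
    _ = _ := by
        rw [Real.div_rpow (by linarith) (by norm_num)]
        field_simp
        norm_num

theorem exists_le_metroGap {am ap : ℝ} (ham : 1 < am) (hap : 1 < ap) :
    ∃ c : ℝ, 0 < c ∧ ∀ Nm Np : ℤ, 0 ≤ Nm → 0 ≤ Np → 1 ≤ Nm + Np →
      c * min (1 / ((Nm : ℝ) + Np) ^ 2) ((1 + (Nm : ℝ)) ^ (-(1 + am))) ≤
        metroGap am ap Nm Np := by
  obtain ⟨K, hK, hKs⟩ := exists_sum_inv_min_metroF_le ham hap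
  refine ⟨1 / (2 * (K + 1)), by positivity, fun Nm Np hm hp hN => ?_⟩
  have hm' : (0 : ℝ) ≤ Nm := by exact_mod_cast hm
  have hp' : (0 : ℝ) ≤ Np := by exact_mod_cast hp
  have hN' : (1 : ℝ) ≤ Nm + Np := by exact_mod_cast hN
  set m := min (1 / ((Nm : ℝ) + Np) ^ 2) ((1 + (Nm : ℝ)) ^ (-(1 + am))) with hmdef
  have hm0 : 0 < m := lt_min (by positivity) (Real.rpow_pos_of_pos (by linarith) _)
  refine le_metroGap am ap hm hp hN (by positivity) fun u => ⟨u Np, ?_⟩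
  set w : ℤ → ℝ := fun x => min (metroF am ap x) (metroF am ap (x + 1)) with hw
  have hwpos : ∀ x, 0 < w x := fun x => lt_min (metroF_pos am ap x) (metroF_pos am ap _)
  have henn : ∀ x, 0 ≤ w x * (u (x + 1) - u x) ^ 2 :=
    fun x => mul_nonneg (hwpos x).le (sq_nonneg _)
  set E := ∑ x ∈ Icc (-Nm) (Np - 1), w x * (u (x + 1) - u x) ^ 2 with hE
  have hE0 : 0 ≤ E := sum_nonneg fun x _ => henn x
  have hpath : ∀ x ∈ Icc (-Nm) Np,
      (u x - u Np) ^ 2 ≤ (∑ y ∈ Icc x (Np - 1), (w y)⁻¹) * E := fun x hx => by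
    rw [mem_Icc] at hx
    refine (sq_sub_le_sum_inv_mul_sum w u hwpos hx.2).trans ?_
    refine mul_le_mul_of_nonneg_left ?_ (sum_nonneg fun y _ => (inv_pos.2 (hwpos y)).le)
    exact sum_le_sum_of_subset_of_nonneg (Icc_subset_Icc hx.1 le_rfl) fun y _ _ => henn y
  have hminus : ∑ x ∈ Icc (-Nm) 0, (u x - u Np) ^ 2 * metroF am ap x ≤
      K * E * (1 + (Nm : ℝ)) ^ (1 + am) := by
    calc _ ≤ ∑ x ∈ Icc (-Nm) 0, K * E * metroF am ap x := sum_le_sum fun x hx => by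
          have hx' : x ∈ Icc (-Nm) Np := Icc_subset_Icc le_rfl hp hx
          exact mul_le_mul_of_nonneg_right
            ((hpath x hx').trans (mul_le_mul_of_nonneg_right (hKs _) hE0)) (metroF_pos am ap x).le
      _ ≤ _ := by
          rw [← mul_sum]
          exact mul_le_mul_of_nonneg_left (sum_metroF_nonpos_le (by linarith) ap hm)
            (by positivity)
  have hplus : ∑ x ∈ Icc 1 Np, (u x - u Np) ^ 2 * metroF am ap x ≤ (Np : ℝ) ^ 2 * E := by
    have hterm : ∀ x ∈ Icc 1 Np, (u x - u Np) ^ 2 * metroF am ap x ≤ Np * E := fun x hx => by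
      have hx' : x ∈ Icc (-Nm) Np := Icc_subset_Icc (by omega) le_rfl hx
      rw [mem_Icc] at hx
      have hx1 : (1 : ℝ) ≤ x := by exact_mod_cast hx.1
      have hinv : ∑ y ∈ Icc x (Np - 1), (w y)⁻¹ ≤ Np * (metroF am ap x)⁻¹ := by
        have hle : ∀ y ∈ Icc x (Np - 1), (w y)⁻¹ ≤ (metroF am ap x)⁻¹ := fun y hy => by
          rw [mem_Icc] at hy
          have hxy : (x : ℝ) ≤ y := by exact_mod_cast hy.1
          refine inv_anti₀ (metroF_pos am ap x) (le_min ?_ ?_)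
          · rw [metroF_of_nonneg (by omega), metroF_of_nonneg (by omega)]
            gcongr
          · rw [metroF_of_nonneg (by omega), metroF_of_nonneg (by omega)]
            push_cast
            gcongr
            linarith
        refine (sum_le_card_nsmul _ _ _ hle).trans ?_
        rw [nsmul_eq_mul]
        refine mul_le_mul_of_nonneg_right ?_ (inv_pos.2 (metroF_pos am ap x)).le
        have : (((Icc x (Np - 1)).card : ℕ) : ℤ) ≤ Np := by rw [Int.card_Icc]; omega
        exact_mod_cast this
      calc _ ≤ Np * (metroF am ap x)⁻¹ * E * metroF am ap x :=
            mul_le_mul_of_nonneg_right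
              ((hpath x hx').trans (mul_le_mul_of_nonneg_right hinv hE0)) (metroF_pos am ap x).le
        _ = Np * E := by
            have := (metroF_pos am ap x).ne'
            field_simp
    refine (sum_le_card_nsmul _ _ _ hterm).trans_eq ?_
    have hc : (((Icc 1 Np).card : ℕ) : ℝ) = Np := by
      have : (((Icc 1 Np).card : ℕ) : ℤ) = Np := by rw [Int.card_Icc]; omega
      exact_mod_cast this
    rw [nsmul_eq_mul, hc]
    ring
  have hmQ : m * (1 + (Nm : ℝ)) ^ (1 + am) ≤ 1 := by
    have h : m ≤ (1 + (Nm : ℝ)) ^ (-(1 + am)) := min_le_right _ _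
    rw [Real.rpow_neg (by linarith)] at h
    rwa [le_inv_comm₀ hm0 (by positivity), ← one_div, le_div_iff₀ hm0, mul_comm] at h
  have hmN : m * (Np : ℝ) ^ 2 ≤ 1 := by
    have h : m ≤ 1 / ((Nm : ℝ) + Np) ^ 2 := min_le_left _ _
    rw [le_div_iff₀ (by positivity)] at h
    refine le_trans ?_ h
    gcongr
    linarith
  rw [sum_Icc_neg_split _ hm hp]
  have htot : m * (∑ x ∈ Icc (-Nm) 0, (u x - u Np) ^ 2 * metroF am ap x +
      ∑ x ∈ Icc 1 Np, (u x - u Np) ^ 2 * metroF am ap x) ≤ (K + 1) * E := by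
    calc _ ≤ m * (K * E * (1 + (Nm : ℝ)) ^ (1 + am) + (Np : ℝ) ^ 2 * E) := by gcongr
      _ = K * E * (m * (1 + (Nm : ℝ)) ^ (1 + am)) + E * (m * (Np : ℝ) ^ 2) := by ring
      _ ≤ K * E * 1 + E * 1 := by gcongr
      _ = _ := by ring
  calc _ = 1 / (2 * (K + 1)) * (m * (∑ x ∈ Icc (-Nm) 0, (u x - u Np) ^ 2 * metroF am ap x +
      ∑ x ∈ Icc 1 Np, (u x - u Np) ^ 2 * metroF am ap x)) := by ring
    _ ≤ 1 / (2 * (K + 1)) * ((K + 1) * E) := by gcongr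
    _ = _ := by field_simp

/-- The two-sided gap estimate when the nonpositive side carries less mass. -/
theorem exists_metroGap_bounds_of_le {am ap : ℝ} (ham : 1 < am) (hap : 1 < ap) :
    ∃ c C : ℝ, 0 < c ∧ 0 < C ∧ ∀ Nm Np : ℤ, 0 ≤ Nm → 0 ≤ Np → 1 ≤ Nm + Np →
      (1 + (Nm : ℝ)) ^ (1 + am) ≤ (1 + (Np : ℝ)) ^ (1 + ap) →
      c * min (1 / ((Nm : ℝ) + Np) ^ 2)
          (max ((1 + (Nm : ℝ)) ^ (-(1 + am))) ((1 + (Np : ℝ)) ^ (-(1 + ap)))) ≤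
        metroGap am ap Nm Np ∧
      metroGap am ap Nm Np ≤ C * min (1 / ((Nm : ℝ) + Np) ^ 2)
          (max ((1 + (Nm : ℝ)) ^ (-(1 + am))) ((1 + (Np : ℝ)) ^ (-(1 + ap)))) := by
  obtain ⟨c, hc, hlow⟩ := exists_le_metroGap ham hap
  obtain ⟨C₁, hC₁, hcut⟩ := exists_metroGap_le_cut (zero_le_one.trans ham.le)
    (zero_le_one.trans hap.le)
  obtain ⟨C₂, hC₂, hdiff⟩ := exists_metroGap_le_diffusive (zero_le_one.trans ham.le)
    (zero_le_one.trans hap.le)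
  refine ⟨c, 4 * C₁ + C₂, hc, by positivity, fun Nm Np hm hp hN hQP => ?_⟩
  have hm' : (0 : ℝ) ≤ Nm := by exact_mod_cast hm
  have hp' : (0 : ℝ) ≤ Np := by exact_mod_cast hp
  have hN' : (1 : ℝ) ≤ Nm + Np := by exact_mod_cast hN
  have hmax : max ((1 + (Nm : ℝ)) ^ (-(1 + am))) ((1 + (Np : ℝ)) ^ (-(1 + ap))) =
      (1 + (Nm : ℝ)) ^ (-(1 + am)) := by
    rw [Real.rpow_neg (by linarith), Real.rpow_neg (by linarith)]
    exact max_eq_left (inv_anti₀ (by positivity) hQP)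
  have hp1 : 1 ≤ Np := by
    by_contra h
    obtain rfl : Np = 0 := by omega
    have h1 : (1 : ℝ) < 1 + (Nm : ℝ) := by
      have : (1 : ℝ) ≤ Nm := by simpa using hN'
      linarith
    have := Real.one_lt_rpow h1 (by linarith : 0 < 1 + am)
    simp at hQP
    linarith
  have hcut' := hcut Nm Np hm hp1
  rw [hmax] at hcut' ⊢
  refine ⟨hlow Nm Np hm hp hN, ?_⟩
  have hA : 0 < (1 + (Nm : ℝ)) ^ (-(1 + am)) := by positivity
  have hB : 0 < 1 / ((Nm : ℝ) + Np) ^ 2 := by positivity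
  rw [mul_min_of_nonneg _ _ (by positivity)]
  refine le_min ?_ (by nlinarith)
  rcases le_total Nm Np with hle | hle
  · have := hdiff Nm Np hm hp1 hle hQP
    nlinarith
  · have hle' : (Np : ℝ) ≤ Nm := by exact_mod_cast hle
    have h4 : (1 + (Nm : ℝ)) ^ (-(1 + am)) ≤ 4 * (1 / ((Nm : ℝ) + Np) ^ 2) := by
      calc (1 + (Nm : ℝ)) ^ (-(1 + am)) ≤ (1 + (Nm : ℝ)) ^ (-2 : ℝ) :=
            Real.rpow_le_rpow_of_exponent_le (by linarith) (by linarith)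
        _ = 1 / (1 + (Nm : ℝ)) ^ 2 := by
            rw [Real.rpow_neg (by linarith), one_div]
            norm_cast
        _ ≤ _ := by
            rw [mul_one_div, div_le_div_iff₀ (by positivity) (by positivity)]
            nlinarith
    nlinarith

/-- Lemma `lem-2`, first case: for `a⁻, a⁺ > 1` the spectral gap
of the asymmetric chain on `{-N⁻,…,N⁺}` is of order
`min{(N⁻+N⁺)^{-2}, max{(1+N⁻)^{-(1+a⁻)}, (1+N⁺)^{-(1+a⁺)}}}`. -/
theorem gap_asymmetric_supercritical (am ap : ℝ) (ham : 1 < am) (hap : 1 < ap) :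
    ∃ c C : ℝ, 0 < c ∧ 0 < C ∧ ∀ Nm Np : ℤ, 0 ≤ Nm → 0 ≤ Np → 1 ≤ Nm + Np →
      c * min (1 / ((Nm : ℝ) + (Np : ℝ)) ^ 2)
          (max (((1 + Nm : ℤ) : ℝ) ^ (-(1 + am))) (((1 + Np : ℤ) : ℝ) ^ (-(1 + ap)))) ≤
        metroGap am ap Nm Np ∧
      metroGap am ap Nm Np ≤
        C * min (1 / ((Nm : ℝ) + (Np : ℝ)) ^ 2)
          (max (((1 + Nm : ℤ) : ℝ) ^ (-(1 + am))) (((1 + Np : ℤ) : ℝ) ^ (-(1 + ap)))) := by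
  obtain ⟨c₁, C₁, hc₁, hC₁, h₁⟩ := exists_metroGap_bounds_of_le ham hap
  obtain ⟨c₂, C₂, hc₂, hC₂, h₂⟩ := exists_metroGap_bounds_of_le hap ham
  refine ⟨min c₁ c₂, max C₁ C₂, lt_min hc₁ hc₂, lt_max_of_lt_left hC₁, fun Nm Np hm hp hN => ?_⟩
  push_cast
  have hm' : (0 : ℝ) ≤ Nm := by exact_mod_cast hm
  have hp' : (0 : ℝ) ≤ Np := by exact_mod_cast hp
  set m := min (1 / ((Nm : ℝ) + Np) ^ 2)
    (max ((1 + (Nm : ℝ)) ^ (-(1 + am))) ((1 + (Np : ℝ)) ^ (-(1 + ap)))) with hmdef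
  have hm0 : 0 ≤ m := by positivity
  rcases le_total ((1 + (Nm : ℝ)) ^ (1 + am)) ((1 + (Np : ℝ)) ^ (1 + ap)) with h | h
  · obtain ⟨hl, hu⟩ := h₁ Nm Np hm hp hN h
    exact ⟨(mul_le_mul_of_nonneg_right (min_le_left _ _) hm0).trans hl,
      hu.trans (mul_le_mul_of_nonneg_right (le_max_left _ _) hm0)⟩
  · obtain ⟨hl, hu⟩ := h₂ Np Nm hp hm (by omega) h
    rw [add_comm (Np : ℝ), max_comm, ← hmdef, metroGap_reflect] at hl hu
    exact ⟨(mul_le_mul_of_nonneg_right (min_le_right _ _) hm0).trans hl,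
      hu.trans (mul_le_mul_of_nonneg_right (le_max_right _ _) hm0)⟩
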